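/- arXiv:2601.18637 — 2 statements merged into one kernel-verified Lean document; each statement's English description precedes it below -/
import Mathlib

section
/- In the normalized unitarily invariant measure μ on the complex projective space CP^{D-1} (pure states of C^D with the trace distance d), every ball of radius δ ∈ (0,1] has measure exactly δ^{2(D-1)}: μ(B_δ(φ)) = δ^{2(D-1)} for every pure state φ. -/
open MeasureTheory

lemma gauss_lint {V : Type*} [NormedAddCommGroup V] [InnerProductSpace ℝ V]
    [FiniteDimensional ℝ V] [MeasurableSpace V] [BorelSpace V] (n : ℕ)
    (hn : Module.finrank ℝ V = 2 * n) {b : ℝ} (hb : 0 < b) :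
    ∫⁻ v : V, ENNReal.ofReal (Real.exp (-b * ‖v‖ ^ 2)) = ENNReal.ofReal ((Real.pi / b) ^ n) := by
  have h := GaussianFourier.integral_rexp_neg_mul_sq_norm (V := V) hb
  have hpos : 0 < (Real.pi / b) ^ ((Module.finrank ℝ V : ℝ) / 2) := by positivity
  have hint : Integrable (fun v : V => Real.exp (-b * ‖v‖ ^ 2)) := by
    by_contra hc
    rw [integral_undef hc] at h
    exact hpos.ne h
  rw [← ofReal_integral_eq_lintegral_ofReal hint (ae_of_all _ fun v => (Real.exp_pos _).le), h, hn]
  congr 1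
  rw [← Real.rpow_natCast]
  congr 1
  push_cast
  ring

lemma radial_lint (s : ℝ) (hs : 0 ≤ s) :
    ∫⁻ r in Set.Ioi (Real.sqrt s), ENNReal.ofReal (r * Real.exp (-r ^ 2))
      = ENNReal.ofReal (Real.exp (-s) / 2) := by
  have hd : ∀ x : ℝ, HasDerivAt (fun r : ℝ => -(Real.exp (-r ^ 2) / 2)) (x * Real.exp (-x ^ 2)) x := by
    intro x
    have h1 : HasDerivAt (fun r : ℝ => -r ^ 2) (-(2 * x)) x := by
      simpa using (hasDerivAt_pow 2 x).fun_neg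
    exact (h1.exp.div_const 2).fun_neg.congr_deriv (by ring)
  have hnn : ∀ x ∈ Set.Ioi (Real.sqrt s), 0 ≤ x * Real.exp (-x ^ 2) := fun x hx =>
    mul_nonneg ((Real.sqrt_nonneg s).trans (le_of_lt hx)) (Real.exp_pos _).le
  have ht : Filter.Tendsto (fun r : ℝ => -(Real.exp (-r ^ 2) / 2)) Filter.atTop (nhds 0) := by
    have : Filter.Tendsto (fun r : ℝ => Real.exp (-r ^ 2)) Filter.atTop (nhds 0) :=
      Real.tendsto_exp_neg_atTop_nhds_zero.comp (Filter.tendsto_pow_atTop (two_ne_zero))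
    simpa using (this.div_const 2).neg
  have hI := integrableOn_Ioi_deriv_of_nonneg (hd _).continuousAt.continuousWithinAt
    (fun x _ => hd x) hnn ht
  rw [← ofReal_integral_eq_lintegral_ofReal hI
    ((ae_restrict_iff' measurableSet_Ioi).2 (ae_of_all _ hnn)),
    integral_Ioi_of_hasDerivAt_of_tendsto (hd _).continuousAt.continuousWithinAt
    (fun x _ => hd x) hI ht, Real.sq_sqrt hs]
  congr 1
  ring

lemma complex_lint (s : ℝ) (hs : 0 ≤ s) :
    ∫⁻ z : ℂ, (if s < ‖z‖ ^ 2 then ENNReal.ofReal (Real.exp (-‖z‖ ^ 2)) else 0)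
      = ENNReal.ofReal (Real.pi * Real.exp (-s)) := by
  rw [← Complex.lintegral_comp_polarCoord_symm]
  have : ∀ p ∈ polarCoord.target, ENNReal.ofReal p.1 •
      (if s < ‖Complex.polarCoord.symm p‖ ^ 2 then
        ENNReal.ofReal (Real.exp (-‖Complex.polarCoord.symm p‖ ^ 2)) else 0)
      = (Set.Ioi (Real.sqrt s)).indicator
        (fun r => ENNReal.ofReal (r * Real.exp (-r ^ 2))) p.1 * 1 := by
    intro p hp
    have hp1 : 0 < p.1 := hp.1
    have hmem : p.1 ∈ Set.Ioi (Real.sqrt s) ↔ s < p.1 ^ 2 := by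
      rw [Set.mem_Ioi, Real.sqrt_lt' hp1]
    rw [Complex.norm_polarCoord_symm, sq_abs, Set.indicator_apply]
    simp only [hmem]
    split_ifs
    · rw [smul_eq_mul, ENNReal.ofReal_mul hp1.le, mul_one]
    · simp
  rw [setLIntegral_congr_fun polarCoord.open_target.measurableSet this, polarCoord_target,
    Measure.volume_eq_prod, ← Measure.prod_restrict]
  rw [lintegral_prod_mul (f := (Set.Ioi (Real.sqrt s)).indicator
        (fun r => ENNReal.ofReal (r * Real.exp (-r ^ 2)))) (g := fun _ => 1)
    ((Measurable.indicator (by fun_prop) measurableSet_Ioi).aemeasurable) (by fun_prop),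
    lintegral_indicator measurableSet_Ioi, Measure.restrict_restrict measurableSet_Ioi,
    Set.inter_eq_left.2 (Set.Ioi_subset_Ioi (Real.sqrt_nonneg s)), radial_lint s hs]
  rw [lintegral_one, Measure.restrict_apply_univ, Real.volume_Ioo, ← ENNReal.ofReal_mul (by positivity)]
  congr 1
  ring

abbrev EE (n : ℕ) := EuclideanSpace ℂ (Fin n)

noncomputable def splitL (n : ℕ) : EE (n + 1) ≃ₗ[ℝ] WithLp 2 (ℂ × EE n) where
  toFun x := WithLp.toLp 2 (x 0, WithLp.toLp 2 (fun i => x i.succ))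
  invFun p := WithLp.toLp 2 (Fin.cons p.fst p.snd)
  map_add' x y := rfl
  map_smul' x y := rfl
  left_inv x := by
    ext i
    refine Fin.cases ?_ (fun j => ?_) i <;> simp
  right_inv p := rfl

noncomputable def splitE (n : ℕ) : EE (n + 1) ≃ₗᵢ[ℝ] WithLp 2 (ℂ × EE n) where
  toLinearEquiv := splitL n
  norm_map' x := by
    rw [← sq_eq_sq₀ (norm_nonneg _) (norm_nonneg _), WithLp.prod_norm_sq_eq_of_L2,
      EuclideanSpace.norm_sq_eq, EuclideanSpace.norm_sq_eq, Fin.sum_univ_succ]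
    rfl

lemma finrank_EE (n : ℕ) : Module.finrank ℝ (EE n) = 2 * n := by
  rw [← Module.finrank_mul_finrank ℝ ℂ (EE n)]
  simp

lemma gauss_set (n : ℕ) (δ : ℝ) (hδ : 0 < δ) (hδ1 : δ ≤ 1) :
    ∫⁻ x : EE (n + 1), (if (1 - δ ^ 2) * ‖x‖ ^ 2 < ‖x 0‖ ^ 2 then
        ENNReal.ofReal (Real.exp (-‖x‖ ^ 2)) else 0)
      = ENNReal.ofReal (δ ^ (2 * n) * Real.pi ^ (n + 1)) := by
  have hmp := (WithLp.volume_preserving_ofLp ℂ (EE n)).comp (splitE n).measurePreserving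
  let f : ℂ × EE n → ENNReal := fun p =>
    (if (1 - δ ^ 2) / δ ^ 2 * ‖p.2‖ ^ 2 < ‖p.1‖ ^ 2 then
        ENNReal.ofReal (Real.exp (-‖p.1‖ ^ 2)) else 0) * ENNReal.ofReal (Real.exp (-‖p.2‖ ^ 2))
  have hf : Measurable f := by
    refine Measurable.mul (Measurable.ite (measurableSet_lt ?_ ?_) ?_ ?_) ?_ <;> fun_prop
  have h1 : ∀ x : EE (n + 1), (if (1 - δ ^ 2) * ‖x‖ ^ 2 < ‖x 0‖ ^ 2 then
        ENNReal.ofReal (Real.exp (-‖x‖ ^ 2)) else 0) = f ((WithLp.ofLp ∘ splitE n) x) := by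
    intro x
    have hx : ‖x‖ ^ 2 = ‖x 0‖ ^ 2 + ‖(splitE n x).snd‖ ^ 2 := by
      rw [← (splitE n).norm_map x, WithLp.prod_norm_sq_eq_of_L2]
      rfl
    have e1 : ((WithLp.ofLp ∘ splitE n) x).1 = x 0 := rfl
    have e2 : ((WithLp.ofLp ∘ splitE n) x).2 = (splitE n x).snd := rfl
    simp only [f, e1, e2, hx]
    have hiff : (1 - δ ^ 2) * (‖x 0‖ ^ 2 + ‖(splitE n x).snd‖ ^ 2) < ‖x 0‖ ^ 2 ↔
        (1 - δ ^ 2) / δ ^ 2 * ‖(splitE n x).snd‖ ^ 2 < ‖x 0‖ ^ 2 := by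
      rw [div_mul_eq_mul_div, div_lt_iff₀ (by positivity)]
      constructor <;> intro h <;> linarith
    simp only [hiff]
    split_ifs
    · rw [← ENNReal.ofReal_mul (Real.exp_pos _).le, ← Real.exp_add]
      congr 2; ring
    · simp
  simp_rw [h1]
  rw [hmp.lintegral_comp hf, Measure.volume_eq_prod, lintegral_prod_symm' _ hf]
  have h2 : ∀ y : EE n, ∫⁻ z : ℂ, f (z, y) = ENNReal.ofReal Real.pi *
      ENNReal.ofReal (Real.exp (-(1 / δ ^ 2) * ‖y‖ ^ 2)) := by
    intro y
    simp only [f]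
    have : 0 ≤ 1 - δ ^ 2 := by nlinarith
    rw [lintegral_mul_const' _ _ ENNReal.ofReal_ne_top, complex_lint _ (by positivity),
      ENNReal.ofReal_mul Real.pi_pos.le, mul_assoc, ← ENNReal.ofReal_mul (Real.exp_pos _).le,
      ← Real.exp_add]
    congr 3
    field_simp
    ring
  simp_rw [h2]
  rw [lintegral_const_mul' _ _ ENNReal.ofReal_ne_top, gauss_lint n (finrank_EE n) (by positivity),
    ← ENNReal.ofReal_mul Real.pi_pos.le]
  congr 1
  rw [div_div_eq_mul_div, div_one, mul_pow, pow_mul]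
  ring

lemma exists_basis (n : ℕ) (φ : EE (n + 1)) (hφ : ‖φ‖ = 1) :
    ∃ b : OrthonormalBasis (Fin (n + 1)) ℂ (EE (n + 1)), b 0 = φ := by
  obtain ⟨b, hb⟩ := Orthonormal.exists_orthonormalBasis_extension_of_card_eq (𝕜 := ℂ)
    (E := EE (n + 1)) (ι := Fin (n + 1)) (by simp) (v := fun _ => φ) (s := {0}) (by
      constructor
      · intro i; exact hφ
      · intro i j hij
        exact absurd (Subsingleton.elim i j) hij)
  exact ⟨b, hb 0 rfl⟩

lemma gauss_set' (n : ℕ) (δ : ℝ) (hδ : 0 < δ) (hδ1 : δ ≤ 1) (ψ : EE (n + 1)) (hψ : ‖ψ‖ = 1) :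
    ∫⁻ x : EE (n + 1), (if (1 - δ ^ 2) * ‖x‖ ^ 2 < ‖(inner ℂ ψ x : ℂ)‖ ^ 2 then
        ENNReal.ofReal (Real.exp (-‖x‖ ^ 2)) else 0)
      = ENNReal.ofReal (δ ^ (2 * n) * Real.pi ^ (n + 1)) := by
  obtain ⟨b, hb⟩ := exists_basis n ψ hψ
  rw [← gauss_set n δ hδ hδ1]
  let e : EE (n + 1) ≃ₗᵢ[ℝ] EE (n + 1) :=
    { toLinearEquiv := b.repr.toLinearEquiv.restrictScalars ℝ
      norm_map' := fun x => b.repr.norm_map x }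
  rw [← e.measurePreserving.lintegral_comp (f := fun x : EE (n + 1) =>
    (if (1 - δ ^ 2) * ‖x‖ ^ 2 < ‖x 0‖ ^ 2 then ENNReal.ofReal (Real.exp (-‖x‖ ^ 2)) else 0))]
  · refine lintegral_congr fun x => ?_
    have h1 : ‖e x‖ = ‖x‖ := e.norm_map x
    have h2 : e x 0 = inner ℂ ψ x := by
      rw [← hb]; exact b.repr_apply_apply x 0
    rw [h1, h2]
  · refine Measurable.ite (measurableSet_lt ?_ ?_) ?_ ?_ <;> fun_prop

lemma mu_set (n : ℕ) (μ : Measure (EE (n + 1)))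
    (hinv : ∀ U ∈ Matrix.unitaryGroup (Fin (n + 1)) ℂ,
      μ.map (fun v => (EuclideanSpace.equiv (Fin (n + 1)) ℂ).symm
        (U.mulVec (EuclideanSpace.equiv (Fin (n + 1)) ℂ v))) = μ)
    (φ : EE (n + 1)) (hφ : ‖φ‖ = 1) (c : ℝ) :
    μ {ψ | ‖ψ‖ = 1 ∧ c < ‖(inner ℂ ψ φ : ℂ)‖ ^ 2} = μ {ψ | ‖ψ‖ = 1 ∧ c < ‖ψ 0‖ ^ 2} := by
  obtain ⟨b, hb⟩ := exists_basis n φ hφ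
  let U : Matrix (Fin (n + 1)) (Fin (n + 1)) ℂ := Matrix.of fun i j => star (b i j)
  have hU : U ∈ Matrix.unitaryGroup (Fin (n + 1)) ℂ := by
    rw [Matrix.mem_unitaryGroup_iff]
    ext i j
    have := orthonormal_iff_ite.1 b.orthonormal i j
    rw [PiLp.inner_apply] at this
    rw [Matrix.mul_apply, Matrix.one_apply, ← this]
    refine Finset.sum_congr rfl fun k _ => ?_
    simp [U, Matrix.star_apply, mul_comm]
  have key : ∀ v : EE (n + 1), (EuclideanSpace.equiv (Fin (n + 1)) ℂ).symm
        (U.mulVec (EuclideanSpace.equiv (Fin (n + 1)) ℂ v)) = b.repr v := by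
    intro v
    ext i
    rw [b.repr_apply_apply, PiLp.inner_apply]
    simp [U, Matrix.mulVec, dotProduct, mul_comm]
  have h := hinv U hU
  simp_rw [key] at h
  have hm : MeasurableSet {ψ : EE (n + 1) | ‖ψ‖ = 1 ∧ c < ‖ψ 0‖ ^ 2} := by
    have m1 : MeasurableSet {ψ : EE (n + 1) | ‖ψ‖ = 1} :=
      measurableSet_eq_fun (by fun_prop) (by fun_prop)
    have m2 : MeasurableSet {ψ : EE (n + 1) | c < ‖ψ 0‖ ^ 2} :=
      measurableSet_lt (by fun_prop) (by fun_prop)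
    exact m1.inter m2
  conv_rhs => rw [← h]
  rw [Measure.map_apply b.repr.continuous.measurable hm]
  congr 1
  ext v
  simp only [Set.mem_ofPred_eq, Set.mem_preimage, b.repr.norm_map, b.repr_apply_apply, hb]
  rw [norm_inner_symm]

lemma main_aux (n : ℕ) (μ : Measure (EE (n + 1))) [IsProbabilityMeasure μ]
    (hsupp : μ (Metric.sphere 0 1) = 1)
    (hinv : ∀ U ∈ Matrix.unitaryGroup (Fin (n + 1)) ℂ,
      μ.map (fun v => (EuclideanSpace.equiv (Fin (n + 1)) ℂ).symm
        (U.mulVec (EuclideanSpace.equiv (Fin (n + 1)) ℂ v))) = μ)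
    (φ : EE (n + 1)) (hφ : ‖φ‖ = 1)
    (δ : ℝ) (hδ : 0 < δ) (hδ1 : δ ≤ 1) :
    μ {ψ | ‖ψ‖ = 1 ∧ 1 - δ ^ 2 < ‖(inner ℂ ψ φ : ℂ)‖ ^ 2} = ENNReal.ofReal (δ ^ (2 * n)) := by
  rw [mu_set n μ hinv φ hφ]
  set F := μ {ψ | ‖ψ‖ = 1 ∧ 1 - δ ^ 2 < ‖ψ 0‖ ^ 2} with hF
  have hae : ∀ᵐ ψ ∂μ, ‖ψ‖ = 1 := by
    have := (prob_compl_eq_zero_iff (μ := μ) (s := Metric.sphere 0 1)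
      Metric.isClosed_sphere.measurableSet).2 hsupp
    refine measure_mono_null ?_ this
    intro x hx
    simpa using hx
  let f : EE (n + 1) → EE (n + 1) → ENNReal := fun ψ x =>
    if (1 - δ ^ 2) * ‖x‖ ^ 2 < ‖(inner ℂ ψ x : ℂ)‖ ^ 2 then
        ENNReal.ofReal (Real.exp (-‖x‖ ^ 2)) else 0
  have hf : Measurable (Function.uncurry f) := by
    refine Measurable.ite (measurableSet_lt ?_ ?_) ?_ ?_ <;> fun_prop
  have hsw := lintegral_lintegral_swap (μ := μ) (ν := (volume : Measure (EE (n + 1)))) hf.aemeasurable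
  have hl : ∫⁻ ψ, ∫⁻ x, f ψ x ∂volume ∂μ = ENNReal.ofReal (δ ^ (2 * n) * Real.pi ^ (n + 1)) := by
    rw [lintegral_congr_ae (g := fun _ => ENNReal.ofReal (δ ^ (2 * n) * Real.pi ^ (n + 1)))]
    · simp
    · filter_upwards [hae] with ψ hψ
      exact gauss_set' n δ hδ hδ1 ψ hψ
  have hr : ∀ x : EE (n + 1), x ≠ 0 →
      ∫⁻ ψ, f ψ x ∂μ = F * ENNReal.ofReal (Real.exp (-1 * ‖x‖ ^ 2)) := by
    intro x hx
    have hx0 : 0 < ‖x‖ := norm_pos_iff.2 hx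
    set φ' : EE (n + 1) := ((‖x‖⁻¹ : ℝ) : ℂ) • x with hφ'
    have hn' : ‖φ'‖ = 1 := by
      rw [hφ', norm_smul, Complex.norm_real, norm_inv, norm_norm, inv_mul_cancel₀ hx0.ne']
    have hms : MeasurableSet {ψ : EE (n + 1) | ‖ψ‖ = 1 ∧ 1 - δ ^ 2 < ‖(inner ℂ ψ φ' : ℂ)‖ ^ 2} := by
      have m1 : MeasurableSet {ψ : EE (n + 1) | ‖ψ‖ = 1} :=
        measurableSet_eq_fun (by fun_prop) (by fun_prop)
      have m2 : MeasurableSet {ψ : EE (n + 1) | 1 - δ ^ 2 < ‖(inner ℂ ψ φ' : ℂ)‖ ^ 2} :=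
        measurableSet_lt (by fun_prop) (by fun_prop)
      exact m1.inter m2
    rw [hF, ← mu_set n μ hinv φ' hn', mul_comm, ← lintegral_indicator_const hms]
    refine lintegral_congr_ae ?_
    filter_upwards [hae] with ψ hψ
    have hiff : (1 - δ ^ 2) * ‖x‖ ^ 2 < ‖(inner ℂ ψ x : ℂ)‖ ^ 2 ↔
        1 - δ ^ 2 < ‖(inner ℂ ψ φ' : ℂ)‖ ^ 2 := by
      rw [hφ', inner_smul_right, norm_mul, Complex.norm_real, norm_inv, norm_norm, mul_pow,
        inv_pow, inv_mul_eq_div, lt_div_iff₀ (by positivity)]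
    simp only [f, Set.indicator_apply, Set.mem_ofPred_eq, hψ, true_and, hiff, neg_one_mul]
  rw [hl, lintegral_congr_ae (g := fun x => F * ENNReal.ofReal (Real.exp (-1 * ‖x‖ ^ 2)))] at hsw
  · rw [lintegral_const_mul' _ _ (measure_ne_top _ _), gauss_lint (n + 1) (finrank_EE _) one_pos,
      div_one, ENNReal.ofReal_mul (by positivity)] at hsw
    exact ((ENNReal.mul_left_inj (by simp [Real.pi_pos]) ENNReal.ofReal_ne_top).1 hsw).symm
  · have : ∀ᵐ x : EE (n + 1), x ≠ 0 := by
      refine (measure_singleton (0 : EE (n + 1)) : volume _ = 0) |> fun h => ?_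
      rw [ae_iff]
      simpa using h
    filter_upwards [this] with x hx using hr x hx

noncomputable abbrev stdM (n : ℕ) : MeasurableSpace (EE n) := inferInstance

lemma stdM_eq (n : ℕ) : stdM n = borel (EE n) := BorelSpace.measurable_eq

/-- In the normalized unitarily invariant probability measure on pure states of `ℂ^D`
(concentrated on the unit sphere), every ball of radius `δ ∈ (0,1]` in the trace distance
`d(ψ,φ) = sqrt (1 - |⟨ψ|φ⟩|²)` has measure exactly `δ^(2(D-1))`. -/
theorem stmt12 (D : ℕ) (hD : 2 ≤ D)
    [MeasurableSpace (EuclideanSpace ℂ (Fin D))] [BorelSpace (EuclideanSpace ℂ (Fin D))]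
    (μ : Measure (EuclideanSpace ℂ (Fin D))) [IsProbabilityMeasure μ]
    (hsupp : μ (Metric.sphere 0 1) = 1)
    (hinv : ∀ U ∈ Matrix.unitaryGroup (Fin D) ℂ,
      μ.map (fun v => (EuclideanSpace.equiv (Fin D) ℂ).symm
        (U.mulVec (EuclideanSpace.equiv (Fin D) ℂ v))) = μ)
    (φ : EuclideanSpace ℂ (Fin D)) (hφ : ‖φ‖ = 1)
    (δ : ℝ) (hδ : δ ∈ Set.Ioc (0:ℝ) 1) :
    μ {ψ | ‖ψ‖ = 1 ∧ Real.sqrt (1 - ‖(inner (𝕜 := ℂ) ψ φ : ℂ)‖ ^ 2) < δ}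
      = ENNReal.ofReal (δ ^ (2 * (D - 1))) := by
  rename_i m hB _
  obtain ⟨n, rfl⟩ : ∃ n, D = n + 1 := ⟨D - 1, by omega⟩
  obtain rfl : m = stdM (n + 1) := hB.measurable_eq.trans (stdM_eq (n + 1)).symm
  rw [Nat.add_sub_cancel, ← main_aux n μ hsupp hinv φ hφ δ hδ.1 hδ.2]
  congr 1
  ext ψ
  simp only [Set.mem_ofPred_eq, Real.sqrt_lt' hδ.1]
  constructor <;> rintro ⟨h1, h2⟩ <;> exact ⟨h1, by linarith⟩
end

section
/- The δ-covering number of the manifold of pure states of C^D (D ≥ 2) under the trace distance satisfies N(M, d, δ) ≤ 5 · D ln(D) · (1/δ)^{2(D-1)} for all δ ∈ (0,1]. -/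
open MeasureTheory

theorem aux_greedy {X : Type*} [MeasurableSpace X] (μ : Measure X) [IsProbabilityMeasure μ]
    (d : X → X → ℝ) (hsymm : ∀ x y, d x y = d y x) (r : ℝ)
    (hmeas : MeasurableSet {p : X × X | d p.1 p.2 < r}) (v : ℝ) (hv0 : 0 ≤ v) (hv1 : v ≤ 1)
    (hv : ∀ y, μ {x | d x y < r} = ENNReal.ofReal v) (N : ℕ) :
    ∃ T : Finset X, T.card ≤ N ∧ MeasurableSet {x | ∀ y ∈ T, r ≤ d x y} ∧
      μ.real {x | ∀ y ∈ T, r ≤ d x y} ≤ (1 - v) ^ N := by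
  classical
  induction N with
  | zero => exact ⟨∅, by simp, by simp, by simp⟩
  | succ N ih =>
    obtain ⟨T, hT, hU, hle⟩ := ih
    set U := {x | ∀ y ∈ T, r ≤ d x y} with hUdef
    have hball : ∀ y, MeasurableSet {x | d x y < r} := fun y =>
      (measurable_id.prodMk measurable_const : Measurable (fun x : X => (x, y))) hmeas
    let A : Set (X × X) := (Prod.snd ⁻¹' U) ∩ {p | d p.1 p.2 < r}
    have hA : MeasurableSet A := (measurable_snd hU).inter hmeas
    have h1 := Measure.prod_apply (μ := μ) (ν := μ) hA
    have h2 := Measure.prod_apply_symm (μ := μ) (ν := μ) hA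
    have h3 : ∀ y, μ ((fun x => (x, y)) ⁻¹' A) = U.indicator (fun _ => ENNReal.ofReal v) y := by
      intro y
      by_cases hy : y ∈ U
      · rw [Set.indicator_of_mem hy, ← hv y]
        congr 1
        ext x
        simp [A, hy]
      · rw [Set.indicator_of_notMem hy]
        convert measure_empty (μ := μ)
        ext x
        simp [A, hy]
    rw [lintegral_congr h3, lintegral_indicator_const hU] at h2
    have hm : Measurable (fun x => μ (Prod.mk x ⁻¹' A)) := measurable_measure_prodMk_left hA
    obtain ⟨x, hx⟩ := exists_lintegral_le (μ := μ) (f := fun x => μ (Prod.mk x ⁻¹' A))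
      (by rw [← h1]; exact measure_ne_top _ _)
    rw [← h1, h2] at hx
    have hAx : Prod.mk x ⁻¹' A = U ∩ {z | d z x < r} := by
      ext z
      simp [A, hsymm x z]
    have hins : {z | ∀ y ∈ insert x T, r ≤ d z y} = U \ {z | d z x < r} := by
      ext z
      simp [hUdef, and_comm]
    refine ⟨insert x T, (Finset.card_insert_le _ _).trans (by omega), ?_, ?_⟩
    · rw [hins]; exact hU.diff (hball x)
    · rw [hins]
      have h5 : v * μ.real U ≤ μ.real (U ∩ {z | d z x < r}) := by
        rw [hAx] at hx
        have := ENNReal.toReal_mono (measure_ne_top _ _) hx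
        rwa [ENNReal.toReal_mul, ENNReal.toReal_ofReal hv0] at this
      have h6 := measureReal_inter_add_sdiff (μ := μ) (s := U) (hball x)
      calc _ ≤ (1 - v) * μ.real U := by linarith
        _ ≤ (1 - v) * (1 - v) ^ N := by gcongr
        _ = _ := by ring

theorem aux_cover {X : Type*} [MeasurableSpace X] (μ : Measure X) [IsProbabilityMeasure μ]
    (d : X → X → ℝ) (hsymm : ∀ x y, d x y = d y x) (htri : ∀ x y z, d x z ≤ d x y + d y z)
    (hself : ∀ x, d x x = 0)
    (hmeas : ∀ r, MeasurableSet {p : X × X | d p.1 p.2 < r}) (r s δ : ℝ) (hs : 0 < s)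
    (hrs : r + s = δ) (hs2 : 2 * s ≤ δ)
    (v w : ℝ) (hv0 : 0 ≤ v) (hv1 : v ≤ 1) (hw : 0 < w)
    (hv : ∀ y, μ {x | d x y < r} = ENNReal.ofReal v)
    (hw' : ∀ y, μ {x | d x y < s} = ENNReal.ofReal w) (N : ℕ) :
    ∃ S : Finset X, (∀ x, ∃ y ∈ S, d x y ≤ δ) ∧ (S.card : ℝ) ≤ N + (1 - v) ^ N / w := by
  classical
  obtain ⟨T, hT, hU, hle⟩ := aux_greedy μ d hsymm r (hmeas r) v hv0 hv1 hv N
  set U := {x | ∀ y ∈ T, r ≤ d x y} with hUdef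
  have hball : ∀ y, MeasurableSet {x | d x y < s} := fun y =>
    (measurable_id.prodMk measurable_const : Measurable (fun x : X => (x, y))) (hmeas s)
  let P : Finset X → Prop := fun F => (∀ y ∈ F, {x | d x y < s} ⊆ U) ∧
    (F : Set X).PairwiseDisjoint (fun y => {x | d x y < s})
  have hcard : ∀ F, P F → (F.card : ℝ) ≤ (1 - v) ^ N / w := by
    rintro F ⟨hF1, hF2⟩
    rw [le_div_iff₀ hw]
    have h := measureReal_biUnion_finset (μ := μ) hF2 (fun y _ => hball y)
    have h' : ∀ y, μ.real {x | d x y < s} = w := fun y => by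
      rw [measureReal_def, hw', ENNReal.toReal_ofReal hw.le]
    simp only [h', Finset.sum_const, nsmul_eq_mul] at h
    rw [← h]
    refine le_trans (measureReal_mono ?_) hle
    simpa using hF1
  have hex : ∃ F, P F ∧ ∀ G, P G → G.card ≤ F.card := by
    let Q : ℕ → Prop := fun k => ∃ F, P F ∧ F.card = k
    have hQ0 : Q 0 := ⟨∅, ⟨by simp, by simp⟩, rfl⟩
    have hb : ∀ k, Q k → k ≤ ⌊(1 - v) ^ N / w⌋₊ := by
      rintro k ⟨F, hF, rfl⟩
      exact Nat.le_floor (hcard F hF)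
    obtain ⟨F, hF, hFc⟩ := Nat.findGreatest_spec (P := Q) (Nat.zero_le _) hQ0
    refine ⟨F, hF, fun G hG => ?_⟩
    rw [hFc]
    exact Nat.le_findGreatest (hb _ ⟨G, hG, rfl⟩) ⟨G, hG, rfl⟩
  obtain ⟨F, hF, hmax⟩ := hex
  refine ⟨T ∪ F, ?_, ?_⟩
  · intro x
    by_contra! hcon
    have hxF : x ∉ F := fun hx => by
      have := hcon x (Finset.mem_union_right _ hx)
      rw [hself] at this
      linarith
    have hP : P (insert x F) := by
      refine ⟨?_, ?_⟩
      · intro y hy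
        rcases Finset.mem_insert.1 hy with rfl | hy
        · intro z hz t ht
          have h1 := hcon t (Finset.mem_union_left _ ht)
          have h2 := htri y z t
          have h3 := hsymm y z
          simp only [Set.mem_ofPred_eq] at hz
          linarith
        · exact hF.1 y hy
      · rw [Finset.coe_insert]
        refine hF.2.insert fun y hy _ => ?_
        rw [Set.disjoint_left]
        intro z hz hz'
        simp only [Set.mem_ofPred_eq] at hz hz'
        have h1 := hcon y (Finset.mem_union_right _ hy)
        have h2 := htri x z y
        have h3 := hsymm x z
        linarith
    have := hmax _ hP
    rw [Finset.card_insert_of_notMem hxF] at this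
    omega
  · have h1 : ((T ∪ F).card : ℝ) ≤ T.card + F.card := by exact_mod_cast Finset.card_union_le _ _
    have h2 : (T.card : ℝ) ≤ N := by exact_mod_cast hT
    linarith [hcard F hF]

theorem aux_dist {E : Type*} [NormedAddCommGroup E] [InnerProductSpace ℂ E] (a c : E)
    (ha : ‖a‖ = 1) (hc : ‖c‖ = 1) (l : ℂ) :
    ‖a - l • c‖ ^ 2 = 1 - ‖inner ℂ a c‖ ^ 2 + ‖l - inner ℂ c a‖ ^ 2 := by
  have h1 : (inner ℂ c a).re = (inner ℂ a c).re := by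
    rw [← inner_conj_symm c a, Complex.conj_re]
  have h2 : (inner ℂ c a).im = -(inner ℂ a c).im := by
    rw [← inner_conj_symm c a, Complex.conj_im]
  rw [@norm_sub_sq ℂ, norm_smul, ha, hc, inner_smul_right]
  simp only [← Complex.normSq_eq_norm_sq, Complex.normSq_apply, mul_one]
  simp [h1, h2]
  ring

theorem aux_tri {E : Type*} [NormedAddCommGroup E] [InnerProductSpace ℂ E] (a b c : E)
    (ha : ‖a‖ = 1) (hb : ‖b‖ = 1) (hc : ‖c‖ = 1) :
    Real.sqrt (1 - ‖inner ℂ a c‖ ^ 2) ≤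
      Real.sqrt (1 - ‖inner ℂ a b‖ ^ 2) + Real.sqrt (1 - ‖inner ℂ b c‖ ^ 2) := by
  have h1 : Real.sqrt (1 - ‖inner ℂ a b‖ ^ 2) = ‖a - inner ℂ b a • b‖ := by
    rw [← Real.sqrt_sq (norm_nonneg (a - inner ℂ b a • b)), aux_dist a b ha hb]; simp
  have h2 : Real.sqrt (1 - ‖inner ℂ b c‖ ^ 2) = ‖b - inner ℂ c b • c‖ := by
    rw [← Real.sqrt_sq (norm_nonneg (b - inner ℂ c b • c)), aux_dist b c hb hc]; simp
  have h3 : Real.sqrt (1 - ‖inner ℂ a c‖ ^ 2) ≤ ‖a - (inner ℂ b a * inner ℂ c b) • c‖ := by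
    apply Real.sqrt_le_iff.2 ⟨norm_nonneg _, ?_⟩
    rw [aux_dist a c ha hc]
    nlinarith [sq_nonneg ‖inner ℂ b a * inner ℂ c b - inner ℂ c a‖]
  have h4 : a - (inner ℂ b a * inner ℂ c b) • c
      = (a - inner ℂ b a • b) + inner ℂ b a • (b - inner ℂ c b • c) := by
    rw [smul_sub, smul_smul]; abel
  have h5 : ‖(inner ℂ b a : ℂ)‖ ≤ 1 := by
    simpa [ha, hb] using norm_inner_le_norm (𝕜 := ℂ) b a
  rw [h1, h2]
  refine h3.trans ?_
  rw [h4]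
  refine (norm_add_le _ _).trans ?_
  rw [norm_smul]
  nlinarith [norm_nonneg (b - inner ℂ c b • c)]

theorem aux_num (D : ℕ) (hD : 4 ≤ D) :
    2 * (D - 1) * (2 * Real.log D) / (1 - 1 / (D:ℝ) ^ 2) ^ (2 * (D - 1)) + 2
      ≤ 5 * D * Real.log D := by
  rcases hD.eq_or_lt with rfl | hD
  · have h : Real.log ((4:ℕ):ℝ) = 2 * Real.log 2 := by
      rw [show ((4:ℕ):ℝ) = 2 ^ 2 by norm_num, Real.log_pow]; norm_num
    rw [h]
    have := Real.log_two_gt_d9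
    norm_num
    linarith
  · have hD' : (5:ℝ) ≤ D := by exact_mod_cast hD
    have hL : (3/2:ℝ) ≤ Real.log D := by
      rw [Real.le_log_iff_exp_le (by linarith)]
      have h1 := Real.exp_one_lt_d9
      have h2 : Real.exp (3/2) ^ 2 = Real.exp 1 ^ 3 := by
        rw [← Real.exp_nat_mul, ← Real.exp_nat_mul]; norm_num
      have h3 : Real.exp 1 ^ 3 ≤ 2.72 ^ 3 := by
        gcongr; linarith
      have : Real.exp (3/2) ≤ 5 := by
        apply le_of_sq_le_sq _ (by norm_num)
        rw [h2]; exact h3.trans (by norm_num)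
      linarith
    have hb : 1 - 2 * ((D:ℝ) - 1) / D ^ 2 ≤ (1 - 1 / (D:ℝ) ^ 2) ^ (2 * (D - 1)) := by
      have h0 : 1 / (D:ℝ) ^ 2 ≤ 1 := by
        rw [div_le_one (by positivity)]; nlinarith
      have := one_add_mul_le_pow (a := -(1 / (D:ℝ) ^ 2)) (by linarith) (2 * (D - 1))
      push_cast [Nat.cast_sub (show 1 ≤ D by omega)] at this
      calc _ = 1 + 2 * ((D:ℝ) - 1) * -(1 / (D:ℝ) ^ 2) := by ring
        _ ≤ _ := this
        _ = _ := by ring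
    have hq : 1 - 2 * ((D:ℝ) - 1) / D ^ 2 = (D ^ 2 - 2 * D + 2) / D ^ 2 := by
      field_simp; ring
    have hq0 : 0 < ((D:ℝ) ^ 2 - 2 * D + 2) := by nlinarith
    set L := Real.log D
    have : 2 * ((D:ℝ) - 1) * (2 * L) / (1 - 1 / (D:ℝ) ^ 2) ^ (2 * (D - 1)) ≤
        2 * ((D:ℝ) - 1) * (2 * L) / ((D ^ 2 - 2 * D + 2) / D ^ 2) := by
      rw [← hq]
      apply div_le_div_of_nonneg_left _ (by rw [hq]; positivity) hb
      apply mul_nonneg <;> linarith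
    have h2 : 2 * ((D:ℝ) - 1) * (2 * L) / ((D ^ 2 - 2 * D + 2) / D ^ 2) + 2 ≤ 5 * D * L := by
      rw [div_div_eq_mul_div, ← le_sub_iff_add_le, div_le_iff₀ hq0]
      obtain ⟨t, ht⟩ : ∃ t : ℝ, (D:ℝ) = 5 + t := ⟨D - 5, by ring⟩
      have ht0 : 0 ≤ t := by linarith
      rw [ht]
      have hk : 0 ≤ (3/2) * ((5+t)^3 - 6 * (5+t)^2 + 10 * (5+t)) - 2 * ((5+t)^2 - 2*(5+t) + 2) := by
        ring_nf; positivity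
      have hk2 : 0 ≤ ((5+t)^3 - 6 * (5+t)^2 + 10 * (5+t)) := by
        ring_nf; positivity
      nlinarith [mul_le_mul_of_nonneg_right hL hk2]
    linarith

/-- The δ-covering number of the manifold of pure states of `ℂ^D` (unit vectors, with
trace distance `sqrt (1 - |⟨ψ|φ⟩|²)`) is at most `5 · D ln D · (1/δ)^(2(D-1))`, assuming
the ball-volume formula for the normalized unitarily invariant measure. -/
theorem stmt17 (D : ℕ) (hD : 2 ≤ D)
    [MeasurableSpace (EuclideanSpace ℂ (Fin D))] [BorelSpace (EuclideanSpace ℂ (Fin D))]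
    (μ : Measure {v : EuclideanSpace ℂ (Fin D) // ‖v‖ = 1}) [IsProbabilityMeasure μ]
    (hvol : ∀ (φ : {v : EuclideanSpace ℂ (Fin D) // ‖v‖ = 1}), ∀ δ ∈ Set.Ioc (0:ℝ) 1,
      μ {ψ | Real.sqrt (1 - ‖(inner (𝕜 := ℂ) ψ.1 φ.1 : ℂ)‖ ^ 2) < δ}
        = ENNReal.ofReal (δ ^ (2 * (D - 1))))
    (δ : ℝ) (hδ : δ ∈ Set.Ioc (0:ℝ) 1) :
    ∃ S : Finset {v : EuclideanSpace ℂ (Fin D) // ‖v‖ = 1},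
      (∀ ψ : {v : EuclideanSpace ℂ (Fin D) // ‖v‖ = 1},
        ∃ φ ∈ S, Real.sqrt (1 - ‖(inner (𝕜 := ℂ) ψ.1 φ.1 : ℂ)‖ ^ 2) ≤ δ) ∧
      (S.card : ℝ) ≤ 5 * D * Real.log D * (1/δ) ^ (2 * (D - 1)) := by
  classical
  obtain ⟨hδ0, hδ1⟩ := hδ
  let d : {v : EuclideanSpace ℂ (Fin D) // ‖v‖ = 1} → {v : EuclideanSpace ℂ (Fin D) // ‖v‖ = 1} → ℝ :=
    fun ψ φ => Real.sqrt (1 - ‖(inner (𝕜 := ℂ) ψ.1 φ.1 : ℂ)‖ ^ 2)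
  have hsymm : ∀ x y, d x y = d y x := fun x y => by
    simp only [d]; rw [norm_inner_symm]
  have htri : ∀ x y z, d x z ≤ d x y + d y z := fun x y z => aux_tri _ _ _ x.2 y.2 z.2
  have hself : ∀ x, d x x = 0 := fun x => by
    simp only [d]
    rw [inner_self_eq_norm_sq_to_K, x.2]; simp
  have hcont : Continuous (fun p : {v : EuclideanSpace ℂ (Fin D) // ‖v‖ = 1} ×
      {v : EuclideanSpace ℂ (Fin D) // ‖v‖ = 1} => d p.1 p.2) := by
    simp only [d]; fun_prop
  have hmeas : ∀ r, MeasurableSet {p : {v : EuclideanSpace ℂ (Fin D) // ‖v‖ = 1} ×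
      {v : EuclideanSpace ℂ (Fin D) // ‖v‖ = 1} | d p.1 p.2 < r} := fun r =>
    (isOpen_lt hcont continuous_const).measurableSet
  set n := 2 * (D - 1) with hn
  have hnR : (n:ℝ) = 2 * ((D:ℝ) - 1) := by
    rw [hn]; push_cast [Nat.cast_sub (show 1 ≤ D by omega)]; ring
  have key : ∀ ε : ℝ, 0 < ε → ε ≤ 1/2 → ∀ N : ℕ,
      ∃ S : Finset {v : EuclideanSpace ℂ (Fin D) // ‖v‖ = 1}, (∀ x, ∃ y ∈ S, d x y ≤ δ) ∧
        (S.card : ℝ) ≤ N + (1 - ((1 - ε) * δ) ^ n) ^ N / (ε * δ) ^ n := by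
    intro ε h0 h1 N
    have hr0 : 0 < (1 - ε) * δ := mul_pos (by linarith) hδ0
    have hr1 : (1 - ε) * δ ≤ 1 := by nlinarith
    have hs0 : 0 < ε * δ := mul_pos h0 hδ0
    have hs1 : ε * δ ≤ 1 := by nlinarith
    exact aux_cover μ d hsymm htri hself hmeas ((1 - ε) * δ) (ε * δ) δ hs0 (by ring) (by nlinarith)
      _ _ (by positivity) (pow_le_one₀ hr0.le hr1) (by positivity)
      (fun y => hvol y _ ⟨hr0, hr1⟩) (fun y => hvol y _ ⟨hs0, hs1⟩) N
  have hδn : 0 < δ ^ n := by positivity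
  have hδn1 : δ ^ n ≤ 1 := pow_le_one₀ hδ0.le hδ1
  rw [one_div, inv_pow]
  by_cases hD4 : 4 ≤ D
  · have hDR : (4:ℝ) ≤ D := by exact_mod_cast hD4
    have hnum := aux_num D hD4
    set ε := 1 / (D:ℝ) ^ 2 with hε
    have hε0 : 0 < ε := by positivity
    have hε1 : ε ≤ 1/2 := by
      rw [hε]; apply one_div_le_one_div_of_le <;> nlinarith
    have hρ : 0 < (1 - ε) ^ n := pow_pos (by linarith) _
    have hlog : 0 < Real.log D := Real.log_pos (by linarith)
    set v := ((1 - ε) * δ) ^ n with hv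
    have hv' : v = (1 - ε) ^ n * δ ^ n := mul_pow _ _ _
    have hv0 : 0 < v := by rw [hv']; positivity
    have hv1 : v ≤ 1 := pow_le_one₀ (mul_nonneg (by linarith) hδ0.le) (by nlinarith)
    set t := (n:ℝ) * (2 * Real.log D) with ht
    obtain ⟨S, hS, hc⟩ := key ε hε0 hε1 ⌈t / v⌉₊
    refine ⟨S, hS, hc.trans ?_⟩
    have ht0 : 0 ≤ t := by positivity
    have hN := Nat.le_ceil (t / v)
    have hN2 := Nat.ceil_lt_add_one (div_nonneg ht0 hv0.le)
    have hεn : Real.exp (-t) = ε ^ n := by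
      rw [ht, hε, ← mul_neg, Real.exp_nat_mul]
      congr 1
      rw [Real.exp_neg, one_div]
      congr 1
      rw [two_mul, Real.exp_add, Real.exp_log (by linarith), sq]
    have hexp : (1 - v) ^ ⌈t / v⌉₊ ≤ ε ^ n := by
      calc (1 - v) ^ ⌈t / v⌉₊ ≤ (Real.exp (-v)) ^ ⌈t / v⌉₊ := by
            apply pow_le_pow_left₀ (by linarith)
            linarith [Real.add_one_le_exp (-v)]
        _ = Real.exp (-(⌈t / v⌉₊ * v)) := by rw [← Real.exp_nat_mul]; ring_nf
        _ ≤ Real.exp (-t) := by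
            apply Real.exp_le_exp.2
            have := (div_le_iff₀ hv0).1 hN
            linarith
        _ = _ := hεn
    have h2 : (1 - v) ^ ⌈t / v⌉₊ / (ε * δ) ^ n ≤ (δ ^ n)⁻¹ := by
      rw [mul_pow, div_le_iff₀ (by positivity)]
      refine hexp.trans (le_of_eq ?_)
      field_simp
    have h3 : (1:ℝ) ≤ (δ ^ n)⁻¹ := (one_le_inv₀ hδn).2 hδn1
    have h4 : t / v = (2 * ((D:ℝ) - 1) * (2 * Real.log D) / (1 - ε) ^ n) * (δ ^ n)⁻¹ := by
      rw [ht, hv', hnR]; field_simp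
    calc _ ≤ (2 * ((D:ℝ) - 1) * (2 * Real.log D) / (1 - ε) ^ n + 2) * (δ ^ n)⁻¹ := by
          rw [add_mul, ← h4]; linarith
      _ ≤ _ := by gcongr
  · obtain ⟨S, hS, hc⟩ := key (1/2) (by norm_num) le_rfl 0
    refine ⟨S, hS, hc.trans ?_⟩
    have h1 : ((0:ℕ):ℝ) + (1 - ((1 - 1/2) * δ) ^ n) ^ 0 / (1/2 * δ) ^ n = 2 ^ n * (δ ^ n)⁻¹ := by
      rw [mul_pow (1/2) δ, one_div, inv_pow, pow_zero]; field_simp; simp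
    rw [h1]
    gcongr
    have : D = 2 ∨ D = 3 := by omega
    rcases this with h | h
    · have := Real.log_two_gt_d9
      rw [hn, h]; norm_num; linarith
    · have h3 : (16/15:ℝ) ≤ Real.log 3 := by
        rw [Real.le_log_iff_exp_le (by norm_num)]
        have h1 := Real.exp_one_lt_d9
        have h2 : Real.exp (16/15) ^ 15 = Real.exp 1 ^ 16 := by
          rw [← Real.exp_nat_mul, ← Real.exp_nat_mul]; norm_num
        have h3 : Real.exp 1 ^ 16 ≤ 2.7183 ^ 16 := by
          gcongr; linarith
        apply le_of_not_gt
        intro hlt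
        have h4 : (3:ℝ) ^ 15 ≤ Real.exp (16/15) ^ 15 := by gcongr
        rw [h2] at h4
        have := h4.trans h3
        norm_num at this
      rw [hn, h]; norm_num; linarith
end
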